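/- In Version C, a position with exactly five piles, whose pile sizes listed in nondecreasing order are a₁ ≤ a₂ ≤ a₃ ≤ a₄ ≤ a₅, is a P-position if and only if the parity pattern (a₁, a₂, a₃, a₄, a₅) mod 2 is one of: (even, even, even, even, even), (even, even, odd, odd, odd), (odd, odd, even, even, odd), (odd, odd, odd, odd, even). -/

import Mathlib

/-- Remove one token from a pile of size `p` in `G`: delete one copy of `p` and,
if `p ≠ 1`, add back a pile of size `p - 1`. -/
def takeOne (G : Multiset ℕ) (p : ℕ) : Multiset ℕ :=
  G.erase p + (if p = 1 then (0 : Multiset ℕ) else {p - 1})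

/-- Legal moves of Version C: remove one token from one chosen pile, or choose two
piles (counted with multiplicity) and remove one token from each of them
(piles reaching size 0 are deleted). -/
inductive MoveC : Multiset ℕ → Multiset ℕ → Prop
  | one {G : Multiset ℕ} {p : ℕ} (hp : p ∈ G) (h1 : 1 ≤ p) : MoveC G (takeOne G p)
  | two {G : Multiset ℕ} {p q : ℕ} (hp : p ∈ G) (hq : q ∈ G.erase p)
      (h1 : 1 ≤ p) (h2 : 1 ≤ q) : MoveC G (takeOne (takeOne G p) q)

mutual
  /-- P-positions of Version C under normal play: every move leads to an N-position
  (in particular the empty position is a P-position).  Since every move strictly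
  decreases the total number of tokens, this inductive definition agrees with the
  usual recursive definition of outcome classes. -/
  inductive PPosC : Multiset ℕ → Prop
    | mk : ∀ {G : Multiset ℕ}, (∀ H, MoveC G H → NPosC H) → PPosC G
  /-- N-positions of Version C under normal play: some move leads to a P-position. -/
  inductive NPosC : Multiset ℕ → Prop
    | mk : ∀ {G H : Multiset ℕ}, MoveC G H → PPosC H → NPosC G
end

/-- No position is both a P-position and an N-position. -/
theorem PPosC.not_NPosC {G : Multiset ℕ} (hG : PPosC G) : ¬ NPosC G :=
  PPosC.rec (motive_1 := fun G _ => ¬ NPosC G) (motive_2 := fun G _ => ¬ PPosC G)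
    (fun _ ih hN => by obtain ⟨m, hP⟩ := hN; exact ih _ m hP)
    (fun m _ ih hP => by obtain ⟨h⟩ := hP; exact ih (h _ m))
    hG

/-- The position obtained from a multiset of pile sizes by discarding the empty piles. -/
def nonemptyPiles (M : Multiset ℕ) : Multiset ℕ := M.filter (0 < ·)

theorem nonemptyPiles_cons_of_pos {p : ℕ} (hp : 0 < p) (M : Multiset ℕ) :
    nonemptyPiles (p ::ₘ M) = p ::ₘ nonemptyPiles M :=
  Multiset.filter_cons_of_pos _ hp

theorem takeOne_nonemptyPiles_cons {p : ℕ} (hp : 0 < p) (M : Multiset ℕ) :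
    takeOne (nonemptyPiles (p ::ₘ M)) p = nonemptyPiles ((p - 1) ::ₘ M) := by
  rw [nonemptyPiles_cons_of_pos hp, takeOne, Multiset.erase_cons_head]
  split_ifs with h
  · simp [nonemptyPiles, h]
  · rw [nonemptyPiles_cons_of_pos (by omega), add_comm, Multiset.singleton_add]

theorem takeOne_takeOne_nonemptyPiles_cons {p q : ℕ} (hp : 0 < p) (hq : 0 < q) (M : Multiset ℕ) :
    takeOne (takeOne (nonemptyPiles (p ::ₘ q ::ₘ M)) p) q =
      nonemptyPiles ((p - 1) ::ₘ (q - 1) ::ₘ M) := by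
  rw [takeOne_nonemptyPiles_cons hp, Multiset.cons_swap,
    takeOne_nonemptyPiles_cons hq, Multiset.cons_swap]

theorem moveC_nonemptyPiles_cons {p : ℕ} (hp : 0 < p) (M : Multiset ℕ) :
    MoveC (nonemptyPiles (p ::ₘ M)) (nonemptyPiles ((p - 1) ::ₘ M)) := by
  rw [← takeOne_nonemptyPiles_cons hp]
  exact .one (by simp [nonemptyPiles_cons_of_pos hp]) hp

theorem moveC_nonemptyPiles_cons_cons {p q : ℕ} (hp : 0 < p) (hq : 0 < q) (M : Multiset ℕ) :
    MoveC (nonemptyPiles (p ::ₘ q ::ₘ M)) (nonemptyPiles ((p - 1) ::ₘ (q - 1) ::ₘ M)) := by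
  rw [← takeOne_takeOne_nonemptyPiles_cons hp hq]
  exact .two (by simp [nonemptyPiles_cons_of_pos hp])
    (by simp [nonemptyPiles_cons_of_pos hp, nonemptyPiles_cons_of_pos hq]) hp hq

/-- `x` is obtained from `y` by removing at most one token. -/
def AtMostOneLess (x y : ℕ) : Prop := x ≤ y ∧ y ≤ x + 1

theorem AtMostOneLess.eq_or_eq_add_one {x y : ℕ} (h : AtMostOneLess x y) :
    y = x ∨ y = x + 1 := by
  obtain ⟨h1, h2⟩ := h
  omega

theorem forall₂_atMostOneLess_refl (l : List ℕ) : List.Forall₂ AtMostOneLess l l :=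
  List.forall₂_same.2 fun _ _ => ⟨le_rfl, Nat.le_succ _⟩

theorem forall₂_atMostOneLess_orderedInsert {x y : ℕ} {m l : List ℕ} (hxy : AtMostOneLess x y)
    (hml : List.Forall₂ AtMostOneLess m l) (hl : (y :: l).Pairwise (· ≤ ·)) :
    List.Forall₂ AtMostOneLess (m.orderedInsert (· ≤ ·) x) (y :: l) := by
  induction hml generalizing y with
  | nil => exact .cons hxy .nil
  | @cons z w r l hzw hrl ih =>
    rw [List.orderedInsert_cons]
    have hyw : y ≤ w := List.rel_of_pairwise_cons hl (by simp)
    obtain ⟨hxy1, hxy2⟩ := hxy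
    obtain ⟨hzw1, hzw2⟩ := hzw
    split_ifs with h
    · exact .cons ⟨hxy1, hxy2⟩ (.cons ⟨hzw1, hzw2⟩ hrl)
    · exact .cons ⟨by omega, by omega⟩ (ih ⟨by omega, by omega⟩ hl.of_cons)

theorem forall₂_atMostOneLess_insertionSort {m l : List ℕ}
    (hml : List.Forall₂ AtMostOneLess m l) (hl : l.Pairwise (· ≤ ·)) :
    List.Forall₂ AtMostOneLess (m.insertionSort (· ≤ ·)) l := by
  induction hml with
  | nil => exact .nil
  | cons hxy _ ih => exact forall₂_atMostOneLess_orderedInsert hxy (ih hl.of_cons) hl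

/-- After a move from a sorted position, the sorted result is termwise at most one less. -/
theorem MoveC.exists_sorted {l : List ℕ} {H : Multiset ℕ} (hl : l.Pairwise (· ≤ ·))
    (hH : MoveC (nonemptyPiles l) H) :
    ∃ m : List ℕ, H = nonemptyPiles m ∧ m.Pairwise (· ≤ ·) ∧ List.Forall₂ AtMostOneLess m l ∧
      m.sum < l.sum ∧ l.sum ≤ m.sum + 2 := by
  suffices ∃ k k' : List ℕ, l.Perm k ∧ H = nonemptyPiles k' ∧ List.Forall₂ AtMostOneLess k' k ∧
      k'.sum < k.sum ∧ k.sum ≤ k'.sum + 2 by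
    obtain ⟨k, k', hlk, rfl, hk, h1, h2⟩ := this
    have hcomp : Relation.Comp (List.Forall₂ AtMostOneLess) List.Perm k' l := ⟨k, hk, hlk.symm⟩
    rw [List.forall₂_comp_perm_eq_perm_comp_forall₂] at hcomp
    obtain ⟨m, hkm, hml⟩ := hcomp
    have hsort := (List.perm_insertionSort (· ≤ ·) m).trans hkm.symm
    refine ⟨m.insertionSort (· ≤ ·), ?_, List.pairwise_insertionSort _ _,
      forall₂_atMostOneLess_insertionSort hml hl, ?_⟩
    · rw [Multiset.coe_eq_coe.2 hsort]
    · rw [hsort.sum_eq, hlk.sum_eq]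
      exact ⟨h1, h2⟩
  generalize hG : nonemptyPiles l = G at hH
  cases hH with
  | @one p hp h1 =>
    subst hG
    have hpl : p ∈ l := by simpa using Multiset.mem_of_mem_filter hp
    obtain ⟨k, hk⟩ : ∃ k, l.Perm (p :: k) := ⟨_, List.perm_cons_erase hpl⟩
    refine ⟨p :: k, (p - 1) :: k, hk, ?_, ?_, ?_⟩
    · rw [Multiset.coe_eq_coe.2 hk]
      exact takeOne_nonemptyPiles_cons h1 (k : Multiset ℕ)
    · exact .cons ⟨by omega, by omega⟩ (forall₂_atMostOneLess_refl k)
    · simp only [List.sum_cons]; omega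
  | @two p q hp hq h1 h2 =>
    subst hG
    have hpl : p ∈ l := by simpa using Multiset.mem_of_mem_filter hp
    have hk := List.perm_cons_erase hpl
    rw [Multiset.coe_eq_coe.2 hk, ← Multiset.cons_coe, nonemptyPiles_cons_of_pos h1,
      Multiset.erase_cons_head] at hq
    have hql : q ∈ l.erase p := by simpa using Multiset.mem_of_mem_filter hq
    have hk' := hk.trans ((List.perm_cons_erase hql).cons p)
    refine ⟨_, (p - 1) :: (q - 1) :: (l.erase p).erase q, hk', ?_, ?_, ?_⟩
    · rw [Multiset.coe_eq_coe.2 hk']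
      exact takeOne_takeOne_nonemptyPiles_cons h1 h2
        ((l.erase p).erase q : List ℕ)
    · exact .cons ⟨by omega, by omega⟩ (.cons ⟨by omega, by omega⟩ (forall₂_atMostOneLess_refl _))
    · simp only [List.sum_cons]; omega

/-- The parity patterns of the five-pile P-positions, as a linear code over `ZMod 2` of minimum
distance three. -/
def ParityCode (a b c d e : ℕ) : Prop :=
  a % 2 = b % 2 ∧ c % 2 = d % 2 ∧ (a + c + e) % 2 = 0

/-- From a sorted position outside the code, some move leads to a sorted position in the code. -/
theorem exists_moveC_parityCode {a b c d e : ℕ} (hab : a ≤ b) (hbc : b ≤ c) (hcd : c ≤ d)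
    (hde : d ≤ e) (h : ¬ ParityCode a b c d e) :
    ∃ a' b' c' d' e', a' ≤ b' ∧ b' ≤ c' ∧ c' ≤ d' ∧ d' ≤ e' ∧ ParityCode a' b' c' d' e' ∧
      a' + b' + c' + d' + e' < a + b + c + d + e ∧
      MoveC (nonemptyPiles {a, b, c, d, e}) (nonemptyPiles {a', b', c', d', e'}) := by
  have one {p : ℕ} {M G H : Multiset ℕ} (hp : 0 < p) (hG : G = p ::ₘ M)
      (hH : H = (p - 1) ::ₘ M) : MoveC (nonemptyPiles G) (nonemptyPiles H) :=
    hG ▸ hH ▸ moveC_nonemptyPiles_cons hp M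
  have two {p q : ℕ} {M G H : Multiset ℕ} (hp : 0 < p) (hq : 0 < q) (hG : G = p ::ₘ q ::ₘ M)
      (hH : H = (p - 1) ::ₘ (q - 1) ::ₘ M) : MoveC (nonemptyPiles G) (nonemptyPiles H) :=
    hG ▸ hH ▸ moveC_nonemptyPiles_cons_cons hp hq M
  simp only [ParityCode, Multiset.insert_eq_cons, ← Multiset.singleton_add] at h one two ⊢
  by_cases hs : a % 2 = b % 2 <;> by_cases ht : c % 2 = d % 2 <;>
    by_cases hu : (a + c + e) % 2 = 0
  · exact absurd ⟨hs, ht, hu⟩ h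
  · by_cases hde' : d = e
    · refine ⟨a - 1, b - 1, c, d, e, by omega, by omega, by omega, by omega, by omega, by omega,
        two (p := a) (q := b) (M := {c} + ({d} + {e})) (by omega) (by omega) ?_ ?_⟩ <;> abel
    · refine ⟨a, b, c, d, e - 1, by omega, by omega, by omega, by omega, by omega, by omega,
        one (p := e) (M := {a} + ({b} + ({c} + {d}))) (by omega) ?_ ?_⟩ <;> abel
  · refine ⟨a, b, c, d - 1, e, by omega, by omega, by omega, by omega, by omega, by omega,
      one (p := d) (M := {a} + ({b} + ({c} + {e}))) (by omega) ?_ ?_⟩ <;> abel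
  · refine ⟨a, b, c, d - 1, e - 1, by omega, by omega, by omega, by omega, by omega, by omega,
      two (p := d) (q := e) (M := {a} + ({b} + {c})) (by omega) (by omega) ?_ ?_⟩ <;> abel
  · refine ⟨a, b - 1, c, d, e, by omega, by omega, by omega, by omega, by omega, by omega,
      one (p := b) (M := {a} + ({c} + ({d} + {e}))) (by omega) ?_ ?_⟩ <;> abel
  · by_cases ha : a = 0
    · refine ⟨a, b - 1, c, d, e - 1, by omega, by omega, by omega, by omega, by omega, by omega,
        two (p := b) (q := e) (M := {a} + ({c} + {d})) (by omega) (by omega) ?_ ?_⟩ <;> abel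
    · refine ⟨a - 1, b, c, d, e, by omega, by omega, by omega, by omega, by omega, by omega,
        one (p := a) (M := {b} + ({c} + ({d} + {e}))) (by omega) ?_ ?_⟩ <;> abel
  · refine ⟨a, b - 1, c, d - 1, e, by omega, by omega, by omega, by omega, by omega, by omega,
      two (p := b) (q := d) (M := {a} + ({c} + {e})) (by omega) (by omega) ?_ ?_⟩ <;> abel
  · refine ⟨a, b - 1, c - 1, d, e, by omega, by omega, by omega, by omega, by omega, by omega,
      two (p := b) (q := c) (M := {a} + ({d} + {e})) (by omega) (by omega) ?_ ?_⟩ <;> abel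

/-- Outcomes of sorted positions with at most five piles, padded with empty piles. -/
theorem nonemptyPiles_outcome {a b c d e : ℕ} (hab : a ≤ b) (hbc : b ≤ c)
    (hcd : c ≤ d) (hde : d ≤ e) :
    (ParityCode a b c d e → PPosC (nonemptyPiles {a, b, c, d, e})) ∧
      (¬ ParityCode a b c d e → NPosC (nonemptyPiles {a, b, c, d, e})) := by
  induction hn : a + b + c + d + e using Nat.strong_induction_on generalizing a b c d e with
  | _ n ih =>
  constructor
  · refine fun h => .mk fun H hH => ?_
    have hl : [a, b, c, d, e].Pairwise (· ≤ ·) := by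
      simp only [List.pairwise_cons, List.mem_cons, List.not_mem_nil, or_false, forall_eq_or_imp,
        forall_eq, List.Pairwise.nil, and_true, IsEmpty.forall_iff, implies_true]
      omega
    obtain ⟨m, rfl, hm, hml, h1, h2⟩ := MoveC.exists_sorted hl hH
    obtain _ | @⟨a', _, _, _, ha, _ | @⟨b', _, _, _, hb, _ | @⟨c', _, _, _, hc, _ |
      @⟨d', _, _, _, hd, _ | @⟨e', _, _, _, he, _ | _⟩⟩⟩⟩⟩ := hml
    simp only [List.pairwise_cons, List.mem_cons, List.not_mem_nil, or_false, forall_eq_or_imp,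
      forall_eq] at hm
    simp only [List.sum_cons, List.sum_nil] at h1 h2
    refine (ih _ ?_ hm.1.1 hm.2.1.1 hm.2.2.1.1 hm.2.2.2.1 rfl).2 ?_
    · omega
    · simp only [ParityCode] at h ⊢
      rcases ha.eq_or_eq_add_one with rfl | rfl <;> rcases hb.eq_or_eq_add_one with rfl | rfl <;>
        rcases hc.eq_or_eq_add_one with rfl | rfl <;> rcases hd.eq_or_eq_add_one with rfl | rfl <;>
        rcases he.eq_or_eq_add_one with rfl | rfl <;> omega
  · intro h
    obtain ⟨a', b', c', d', e', h1, h2, h3, h4, hcode, hlt, hmove⟩ :=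
      exists_moveC_parityCode hab hbc hcd hde h
    exact .mk hmove ((ih _ (hn ▸ hlt) h1 h2 h3 h4 rfl).1 hcode)

/-- In Version C, a five-pile position with pile sizes listed in nondecreasing order
`a1 ≤ a2 ≤ a3 ≤ a4 ≤ a5` is a P-position iff the parity pattern is one of
(e,e,e,e,e), (e,e,o,o,o), (o,o,e,e,o), (o,o,o,o,e). -/
theorem versionC_five_piles (a1 a2 a3 a4 a5 : ℕ) (h1 : 1 ≤ a1)
    (h12 : a1 ≤ a2) (h23 : a2 ≤ a3) (h34 : a3 ≤ a4) (h45 : a4 ≤ a5) :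
    PPosC {a1, a2, a3, a4, a5} ↔
      (Even a1 ∧ Even a2 ∧ Even a3 ∧ Even a4 ∧ Even a5) ∨
      (Even a1 ∧ Even a2 ∧ Odd a3 ∧ Odd a4 ∧ Odd a5) ∨
      (Odd a1 ∧ Odd a2 ∧ Even a3 ∧ Even a4 ∧ Odd a5) ∨
      (Odd a1 ∧ Odd a2 ∧ Odd a3 ∧ Odd a4 ∧ Even a5) := by
  have hpos : nonemptyPiles {a1, a2, a3, a4, a5} = {a1, a2, a3, a4, a5} := by
    refine Multiset.filter_eq_self.2 fun x hx => ?_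
    simp only [Multiset.insert_eq_cons, Multiset.mem_cons, Multiset.mem_singleton] at hx
    omega
  have hcode : PPosC {a1, a2, a3, a4, a5} ↔ ParityCode a1 a2 a3 a4 a5 := by
    have h := nonemptyPiles_outcome h12 h23 h34 h45
    rw [hpos] at h
    exact ⟨fun hP => by_contra fun hc => hP.not_NPosC (h.2 hc), h.1⟩
  rw [hcode]
  simp only [ParityCode, Nat.even_iff, Nat.odd_iff]
  rcases Nat.mod_two_eq_zero_or_one a1 with ho1 | ho1 <;>
    rcases Nat.mod_two_eq_zero_or_one a3 with ho3 | ho3 <;> simp [ho1, ho3] <;> omega
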